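/- arXiv:1707.08206 — 5 statements merged into one kernel-verified Lean document; each statement's English description precedes it below -/
import Mathlib

section
/- Let p_1, p_0 ∈ ℝ and suppose 0 ≤ p_d i ≤ 1 and 0 ≤ p_f i ≤ 1 for all i. Then the Chair–Varshney indicator rule x*(S) = 1 if p_1·g(p_d,S) − p_0·g(p_f,S) > 0 and x*(S) = 0 otherwise, maximizes the Bayesian objective p_1·P_D(x) − p_0·P_F(x) over all fusion rules x with x(S) ∈ {0,1} for all S; moreover the maximum value equals ∑_{S ⊆ Fin N} max(p_1·g(p_d,S) − p_0·g(p_f,S), 0). -/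
open Finset

/-- `g p S` is the probability of the decision vector whose `i`-th entry is `1` iff `i ∈ S`. -/
def g {N : ℕ} (p : Fin N → ℝ) (S : Finset (Fin N)) : ℝ :=
  (∏ i ∈ S, p i) * ∏ i ∈ Sᶜ, (1 - p i)

/-- Probability of detection of the system for fusion rule `x`. -/
def PD {N : ℕ} (p_d : Fin N → ℝ) (x : Finset (Fin N) → ℝ) : ℝ :=
  ∑ S : Finset (Fin N), x S * g p_d S

/-- Probability of false alarm of the system for fusion rule `x`. -/
def PF {N : ℕ} (p_f : Fin N → ℝ) (x : Finset (Fin N) → ℝ) : ℝ :=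
  ∑ S : Finset (Fin N), x S * g p_f S

/-- The Chair–Varshney indicator fusion rule. -/
noncomputable def cvRule {N : ℕ} (p_d p_f : Fin N → ℝ) (p₁ p₀ : ℝ) (S : Finset (Fin N)) : ℝ :=
  if p₁ * g p_d S - p₀ * g p_f S > 0 then 1 else 0

theorem objective_eq_sum {N : ℕ} (p_d p_f : Fin N → ℝ) (p₁ p₀ : ℝ) (x : Finset (Fin N) → ℝ) :
    p₁ * PD p_d x - p₀ * PF p_f x
      = ∑ S : Finset (Fin N), x S * (p₁ * g p_d S - p₀ * g p_f S) := by
  simp only [PD, PF, Finset.mul_sum, ← Finset.sum_sub_distrib]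
  exact Finset.sum_congr rfl fun S _ => by ring

theorem cvRule_mul_eq_max {N : ℕ} (p_d p_f : Fin N → ℝ) (p₁ p₀ : ℝ) (S : Finset (Fin N)) :
    cvRule p_d p_f p₁ p₀ S * (p₁ * g p_d S - p₀ * g p_f S)
      = max (p₁ * g p_d S - p₀ * g p_f S) 0 := by
  unfold cvRule
  split_ifs with h
  · rw [one_mul, max_eq_left h.le]
  · rw [zero_mul, max_eq_right (not_lt.mp h)]

theorem cv_rule_optimal {N : ℕ} (p_d p_f : Fin N → ℝ) (p₁ p₀ : ℝ)
    (hpd : ∀ i, 0 ≤ p_d i ∧ p_d i ≤ 1) (hpf : ∀ i, 0 ≤ p_f i ∧ p_f i ≤ 1) :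
    (∀ x : Finset (Fin N) → ℝ, (∀ S, x S = 0 ∨ x S = 1) →
      p₁ * PD p_d x - p₀ * PF p_f x
        ≤ p₁ * PD p_d (cvRule p_d p_f p₁ p₀) - p₀ * PF p_f (cvRule p_d p_f p₁ p₀)) ∧
    p₁ * PD p_d (cvRule p_d p_f p₁ p₀) - p₀ * PF p_f (cvRule p_d p_f p₁ p₀)
      = ∑ S : Finset (Fin N), max (p₁ * g p_d S - p₀ * g p_f S) 0 := by
  simp only [objective_eq_sum, cvRule_mul_eq_max]
  refine ⟨fun x hx => Finset.sum_le_sum fun S _ => ?_, trivial⟩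
  rcases hx S with h | h <;> simp [h]
end

section
/- Let 0 < p_f < p_d < 1, p_0 > 0, p_1 > 0, and let N be a positive integer. Define R(k) = p_1 · p_d^k · (1 − p_d)^{N−k} − p_0 · p_f^k · (1 − p_f)^{N−k} for 0 ≤ k ≤ N. Then the set {k : 0 ≤ k ≤ N, R(k) > 0} is upward closed: if 0 ≤ k ≤ k' ≤ N and R(k) > 0, then R(k') > 0. -/
theorem positive_votes_upward_closed (p_f p_d p₀ p₁ : ℝ) (N : ℕ)
    (hpf : 0 < p_f) (hfd : p_f < p_d) (hpd : p_d < 1)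
    (hp0 : 0 < p₀) (hp1 : 0 < p₁) (hN : 0 < N)
    (R : ℕ → ℝ)
    (hR : ∀ k ≤ N, R k = p₁ * p_d ^ k * (1 - p_d) ^ (N - k)
                          - p₀ * p_f ^ k * (1 - p_f) ^ (N - k))
    (k k' : ℕ) (hkk' : k ≤ k') (hk' : k' ≤ N) (hpos : R k > 0) :
    R k' > 0 := by
  rw [hR k (hkk'.trans hk')] at hpos
  rw [hR k' hk']
  obtain ⟨m, rfl⟩ := Nat.exists_eq_add_of_le hkk'
  obtain ⟨j, rfl⟩ := Nat.exists_eq_add_of_le hk'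
  rw [show k + m + j - k = j + m by omega, pow_add, pow_add] at hpos
  rw [show k + m + j - (k + m) = j by omega, pow_add, pow_add]
  have hqd : 0 < 1 - p_d := by linarith
  have hqf : 0 < 1 - p_f := by linarith
  have hB : 0 < p₀ * p_f ^ k * (1 - p_f) ^ j := by positivity
  have hq : (1 - p_d) ^ m ≤ (1 - p_f) ^ m := by gcongr
  have hp : p_f ^ m ≤ p_d ^ m := by gcongr
  have hAB : p₀ * p_f ^ k * (1 - p_f) ^ j < p₁ * p_d ^ k * (1 - p_d) ^ j := by
    refine lt_of_mul_lt_mul_right ?_ (pow_nonneg hqd.le m)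
    have := mul_le_mul_of_nonneg_left hq hB.le
    linarith
  have h₁ := mul_le_mul_of_nonneg_left hp hB.le
  have h₂ := mul_lt_mul_of_pos_right hAB (pow_pos (hpf.trans hfd) m)
  linarith
end

section
/- Let 0 < p_f < p_d < 1, p_0 > 0, p_1 > 0, and let N be a positive integer. Define R_K(k) = (N choose k) · (p_1 · p_d^k · (1 − p_d)^{N−k} − p_0 · p_f^k · (1 − p_f)^{N−k}) for 0 ≤ k ≤ N. Suppose there exists k with R_K(k) > 0 and let K* be the least such k. Then for every y : ℕ → ℝ with y(k) ∈ {0,1} for all k, ∑_{k=0}^{N} y(k)·R_K(k) ≤ ∑_{k=K*}^{N} R_K(k); that is, the K-out-of-N voting rule with threshold K* maximizes the Bayesian objective over all count-based 0-1 fusion rules. -/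
open Finset

/-- Shifting the exponents of a Bernoulli weight from `j` to `k` successes trades a factor
`(1 - p) ^ (k - j)` for `p ^ (k - j)`. -/
lemma bernoulli_weight_shift (p : ℝ) {j k N : ℕ} (hjk : j ≤ k) (hkN : k ≤ N) :
    p ^ k * (1 - p) ^ (N - k) * (1 - p) ^ (k - j) =
      p ^ j * (1 - p) ^ (N - j) * p ^ (k - j) := by
  have hk : p ^ k = p ^ j * p ^ (k - j) := by rw [← pow_add, Nat.add_sub_cancel' hjk]
  have hN : (1 - p) ^ (N - j) = (1 - p) ^ (N - k) * (1 - p) ^ (k - j) := by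
    rw [← pow_add, Nat.sub_add_sub_cancel hkN hjk]
  rw [hk, hN]
  ring

/-- Monotone likelihood ratio: once the weighted likelihood under `q` dominates the one under
`p < q`, it does so for every larger number of successes. -/
lemma weighted_likelihood_le_of_le {p q a b : ℝ} {j k N : ℕ} (hp : 0 < p) (hpq : p < q)
    (hq : q < 1) (hb : 0 ≤ b) (hjk : j ≤ k) (hkN : k ≤ N)
    (h : a * p ^ j * (1 - p) ^ (N - j) ≤ b * q ^ j * (1 - q) ^ (N - j)) :
    a * p ^ k * (1 - p) ^ (N - k) ≤ b * q ^ k * (1 - q) ^ (N - k) := by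
  have hp' : 0 < 1 - p := by linarith
  have hq' : 0 < 1 - q := by linarith
  have hq0 : 0 < q := hp.trans hpq
  have hodds : (p * (1 - q)) ^ (k - j) ≤ (q * (1 - p)) ^ (k - j) :=
    pow_le_pow_left₀ (by positivity) (by linarith) _
  refine le_of_mul_le_mul_right ?_ (by positivity : 0 < ((1 - p) * (1 - q)) ^ (k - j))
  calc a * p ^ k * (1 - p) ^ (N - k) * ((1 - p) * (1 - q)) ^ (k - j)
      = a * (p ^ k * (1 - p) ^ (N - k) * (1 - p) ^ (k - j)) * (1 - q) ^ (k - j) := by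
        rw [mul_pow]; ring
    _ = a * p ^ j * (1 - p) ^ (N - j) * (p * (1 - q)) ^ (k - j) := by
        rw [bernoulli_weight_shift p hjk hkN, mul_pow]; ring
    _ ≤ b * q ^ j * (1 - q) ^ (N - j) * (q * (1 - p)) ^ (k - j) :=
        mul_le_mul h hodds (by positivity) (by positivity)
    _ = b * (q ^ j * (1 - q) ^ (N - j) * q ^ (k - j)) * (1 - p) ^ (k - j) := by
        rw [mul_pow]; ring
    _ = b * q ^ k * (1 - q) ^ (N - k) * ((1 - p) * (1 - q)) ^ (k - j) := by
        rw [← bernoulli_weight_shift q hjk hkN, mul_pow]; ring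

theorem k_out_of_n_optimal (p_f p_d p₀ p₁ : ℝ) (N : ℕ)
    (hpf : 0 < p_f) (hfd : p_f < p_d) (hpd : p_d < 1)
    (hp0 : 0 < p₀) (hp1 : 0 < p₁) (hN : 0 < N)
    (R_K : ℕ → ℝ)
    (hRK : ∀ k ≤ N, R_K k = (N.choose k : ℝ) *
        (p₁ * p_d ^ k * (1 - p_d) ^ (N - k) - p₀ * p_f ^ k * (1 - p_f) ^ (N - k)))
    (Kstar : ℕ) (hKstar : Kstar ≤ N) (hKpos : R_K Kstar > 0)
    (hleast : ∀ k ≤ N, R_K k > 0 → Kstar ≤ k) :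
    ∀ y : ℕ → ℝ, (∀ k, y k = 0 ∨ y k = 1) →
      ∑ k ∈ Finset.range (N + 1), y k * R_K k ≤ ∑ k ∈ Finset.Icc Kstar N, R_K k := by
  intro y hy
  have hKdiff := hKpos
  rw [hRK Kstar hKstar] at hKdiff
  have hKle := sub_nonneg.mp (pos_of_mul_pos_right hKdiff (Nat.cast_nonneg _)).le
  have hnonneg : ∀ k, Kstar ≤ k → k ≤ N → 0 ≤ R_K k := fun k hk hkN => by
    rw [hRK k hkN]
    exact mul_nonneg (Nat.cast_nonneg _) (sub_nonneg.mpr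
      (weighted_likelihood_le_of_le hpf hfd hpd hp1.le hk hkN hKle))
  have hIcc : Finset.Icc Kstar N = (Finset.range (N + 1)).filter (Kstar ≤ ·) := by
    ext k
    simp only [Finset.mem_Icc, Finset.mem_filter, Finset.mem_range]
    omega
  rw [hIcc, Finset.sum_filter]
  refine Finset.sum_le_sum fun k hk => ?_
  have hkN : k ≤ N := Nat.lt_succ_iff.mp (Finset.mem_range.mp hk)
  split_ifs with hKk
  · rcases hy k with h | h <;> simp [h, hnonneg k hKk hkN]
  · have hR : R_K k ≤ 0 := not_lt.mp fun h => hKk (hleast k hkN h)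
    rcases hy k with h | h <;> simp [h, hR]
end

section
/- Let 0 < p_f < p_d < 1 and let N be a positive integer. Set β = ln(p_f/p_d) / ln((1 − p_d)/(1 − p_f)). Then β > 0, and for every natural number k with 0 ≤ k ≤ N: p_d^k · (1 − p_d)^{N−k} > p_f^k · (1 − p_f)^{N−k} if and only if k > N/(1 + β). -/
theorem log_pow_mul_pow {x y : ℝ} (hx : 0 < x) (hy : 0 < y) (m n : ℕ) :
    Real.log (x ^ m * y ^ n) = m * Real.log x + n * Real.log y := by
  rw [Real.log_mul (by positivity) (by positivity), Real.log_pow, Real.log_pow]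

theorem threshold_characterization (p_f p_d : ℝ) (N : ℕ)
    (hpf : 0 < p_f) (hfd : p_f < p_d) (hpd : p_d < 1) (hN : 0 < N)
    (β : ℝ) (hβ : β = Real.log (p_f / p_d) / Real.log ((1 - p_d) / (1 - p_f))) :
    0 < β ∧
    ∀ k : ℕ, k ≤ N →
      (p_d ^ k * (1 - p_d) ^ (N - k) > p_f ^ k * (1 - p_f) ^ (N - k) ↔
        (k : ℝ) > (N : ℝ) / (1 + β)) := by
  have hd : 0 < p_d := hpf.trans hfd
  have hd' : 0 < 1 - p_d := by linarith
  have hf' : 0 < 1 - p_f := by linarith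
  rw [Real.log_div hpf.ne' hd.ne', Real.log_div hd'.ne' hf'.ne'] at hβ
  have ha : Real.log p_f - Real.log p_d < 0 := sub_neg.2 (Real.log_lt_log hpf hfd)
  have hb : Real.log (1 - p_d) - Real.log (1 - p_f) < 0 :=
    sub_neg.2 (Real.log_lt_log hd' (by linarith))
  have hβ_pos : 0 < β := hβ ▸ div_pos_of_neg_of_neg ha hb
  have hβ_mul := (eq_div_iff hb.ne).1 hβ
  refine ⟨hβ_pos, fun k hk => ?_⟩
  rw [gt_iff_lt, gt_iff_lt, div_lt_iff₀ (by linarith),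
    ← Real.log_lt_log_iff (by positivity) (by positivity),
    log_pow_mul_pow hpf hf', log_pow_mul_pow hd hd', Nat.cast_sub hk,
    ← sub_pos, ← sub_neg (a := (N : ℝ))]
  have key : k * Real.log p_d + (N - k) * Real.log (1 - p_d) -
      (k * Real.log p_f + (N - k) * Real.log (1 - p_f)) =
      (N - k * (1 + β)) * (Real.log (1 - p_d) - Real.log (1 - p_f)) := by
    linear_combination (k : ℝ) * hβ_mul
  rw [key, mul_pos_iff, and_iff_left hb, or_iff_right fun h => h.2.not_gt hb]
end

section
/- Let 0 < p_f < p_d < 1, let N be a positive integer, and set β = ln(p_f/p_d) / ln((1 − p_d)/(1 − p_f)). Assume N/(1 + β) is not an integer. Then the least natural number k with p_d^k · (1 − p_d)^{N−k} > p_f^k · (1 − p_f)^{N−k} equals ⌈N/(1 + β)⌉, and this number lies in {0, 1, …, N}. -/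
/-- For `k ≤ N`, the vote count `k` favours detection iff its log-likelihood ratio is positive. -/
theorem pow_mul_pow_lt_iff_log {p q : ℝ} {N k : ℕ} (hq : 0 < q) (hqp : q < p) (hp : p < 1)
    (hk : k ≤ N) :
    q ^ k * (1 - q) ^ (N - k) < p ^ k * (1 - p) ^ (N - k) ↔
      ((N : ℝ) - k) * (Real.log (1 - q) - Real.log (1 - p)) <
        k * (Real.log p - Real.log q) := by
  have hp0 : 0 < p := hq.trans hqp
  have hp1 : 0 < 1 - p := sub_pos.2 hp
  have hq1 : 0 < 1 - q := sub_pos.2 (hqp.trans hp)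
  rw [← Real.log_lt_log_iff (by positivity) (by positivity),
    Real.log_mul (by positivity) (by positivity), Real.log_mul (by positivity) (by positivity),
    Real.log_pow, Real.log_pow, Real.log_pow, Real.log_pow, Nat.cast_sub hk]
  constructor <;> intro h <;> linarith

theorem optimal_threshold_is_ceiling (p_f p_d : ℝ) (N : ℕ)
    (hpf : 0 < p_f) (hfd : p_f < p_d) (hpd : p_d < 1) (hN : 0 < N)
    (β : ℝ) (hβ : β = Real.log (p_f / p_d) / Real.log ((1 - p_d) / (1 - p_f)))
    (hnotint : ∀ m : ℤ, (N : ℝ) / (1 + β) ≠ (m : ℝ)) :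
    IsLeast {k : ℕ | p_d ^ k * (1 - p_d) ^ (N - k) > p_f ^ k * (1 - p_f) ^ (N - k)}
        (⌈(N : ℝ) / (1 + β)⌉.toNat) ∧
    (⌈(N : ℝ) / (1 + β)⌉.toNat ≤ N) := by
  have hpd0 : 0 < p_d := hpf.trans hfd
  have hpd1 : 0 < 1 - p_d := sub_pos.2 hpd
  have hpf1 : 0 < 1 - p_f := sub_pos.2 (hfd.trans hpd)
  have ha : 0 < Real.log p_d - Real.log p_f := sub_pos.2 (Real.log_lt_log hpf hfd)
  have hb : 0 < Real.log (1 - p_f) - Real.log (1 - p_d) :=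
    sub_pos.2 (Real.log_lt_log hpd1 (by linarith))
  have hβ' : β = (Real.log p_d - Real.log p_f) / (Real.log (1 - p_f) - Real.log (1 - p_d)) := by
    rw [hβ, Real.log_div hpf.ne' hpd0.ne', Real.log_div hpd1.ne' hpf1.ne', ← neg_div_neg_eq,
      neg_sub, neg_sub]
  have hβ0 : 0 < β := hβ' ▸ div_pos ha hb
  have hmul : Real.log p_d - Real.log p_f = β * (Real.log (1 - p_f) - Real.log (1 - p_d)) := by
    rw [hβ', div_mul_cancel₀ _ hb.ne']
  have key : ∀ k ≤ N, (p_f ^ k * (1 - p_f) ^ (N - k) < p_d ^ k * (1 - p_d) ^ (N - k) ↔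
      (N : ℝ) / (1 + β) < k) := by
    intro k hk
    rw [pow_mul_pow_lt_iff_log hpf hfd hpd hk, hmul, ← mul_assoc, mul_lt_mul_iff_left₀ hb,
      div_lt_iff₀ (by linarith)]
    constructor <;> intro h <;> linarith
  rw [Int.ceil_toNat]
  have hle : ⌈(N : ℝ) / (1 + β)⌉₊ ≤ N :=
    Nat.ceil_le.2 (div_le_self (Nat.cast_nonneg N) (by linarith))
  refine ⟨⟨(key _ hle).2 (lt_of_le_of_ne (Nat.le_ceil _) ?_), fun k hk => ?_⟩, hle⟩
  · exact_mod_cast hnotint (⌈(N : ℝ) / (1 + β)⌉₊ : ℤ)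
  · rcases le_total k N with hkN | hkN
    · exact Nat.ceil_le.2 ((key k hkN).1 hk).le
    · exact hle.trans hkN
end
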